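/- (Mutual information of the forward-channel realization equals the memoryless Gaussian rate-distortion function.) Let σ² > 0 and 0 < D ≤ σ², and set α := √(1 − D/σ²). Let μ be the pushforward of (gaussianReal 0 σ²) ⊗ (gaussianReal 0 D) on ℝ² under the map (x, n) ↦ (x, αx + n). Then the second marginal of μ is gaussianReal 0 σ², and klDiv( μ , (gaussianReal 0 σ²) ⊗ (gaussianReal 0 σ²) ) = (1/2) log(σ²/D) nats. -/

import Mathlib

open MeasureTheory ProbabilityTheory Real

/-- Kullback–Leibler divergence `∫ log(dμ/dν) dμ` in nats. -/
noncomputable def klDiv {α : Type*} [MeasurableSpace α] (μ ν : Measure α) : ℝ :=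
  ∫ x, Real.log (μ.rnDeriv ν x).toReal ∂μ

/-- Two nondegenerate Gaussian measures are related by the quotient of their densities. -/
lemma gaussianReal_withDensity_div (m m' : ℝ) {v v' : NNReal} (hv : v ≠ 0) (hv' : v' ≠ 0) :
    (gaussianReal m' v').withDensity
      (fun y => ENNReal.ofReal (gaussianPDFReal m v y / gaussianPDFReal m' v' y)) =
      gaussianReal m v := by
  rw [gaussianReal_of_var_ne_zero m' hv', gaussianReal_of_var_ne_zero m hv,
    ← withDensity_mul _ (measurable_gaussianPDF m' v') (by fun_prop)]
  congr 1
  ext y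
  have h := gaussianPDFReal_pos m' v' y hv'
  rw [Pi.mul_apply, gaussianPDF, gaussianPDF, ← ENNReal.ofReal_mul h.le,
    mul_div_cancel₀ _ h.ne']

/-- The logarithm of the quotient of two nondegenerate Gaussian densities. -/
lemma log_gaussianPDFReal_div (m m' : ℝ) {v v' : NNReal} (hv : 0 < v) (hv' : 0 < v') (y : ℝ) :
    Real.log (gaussianPDFReal m v y / gaussianPDFReal m' v' y) =
      (1 / 2) * Real.log ((v' : ℝ) / v) - (y - m) ^ 2 / (2 * v) + (y - m') ^ 2 / (2 * v') := by
  have h : (0 : ℝ) < v := hv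
  have h' : (0 : ℝ) < v' := hv'
  have hlog (w : ℝ) (hw : 0 < w) (t : ℝ) :
      Real.log ((√(2 * π * w))⁻¹ * Real.exp t) =
        -((1 / 2) * (Real.log (2 * π) + Real.log w)) + t := by
    rw [Real.log_mul (by positivity) (by positivity), Real.log_exp, Real.log_inv,
      Real.log_sqrt (by positivity), Real.log_mul (by positivity) hw.ne']
    ring
  rw [Real.log_div (gaussianPDFReal_pos _ _ _ hv.ne').ne' (gaussianPDFReal_pos _ _ _ hv'.ne').ne',
    Real.log_div h'.ne' h.ne', gaussianPDFReal, gaussianPDFReal, hlog _ h, hlog _ h']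
  ring

/-- Joint law of the input and output of an additive Gaussian channel, as a density with respect to
a product of Gaussians. -/
lemma map_prod_gaussianReal_eq_withDensity (a : ℝ) (P : Measure ℝ) [IsProbabilityMeasure P]
    {v v' : NNReal} (hv : v ≠ 0) (hv' : v' ≠ 0) :
    (P.prod (gaussianReal 0 v)).map (fun p : ℝ × ℝ => (p.1, a * p.1 + p.2)) =
      (P.prod (gaussianReal 0 v')).withDensity (fun p => ENNReal.ofReal
        (gaussianPDFReal (a * p.1) v p.2 / gaussianPDFReal 0 v' p.2)) := by
  have hmeas : Measurable (fun p : ℝ × ℝ => (p.1, a * p.1 + p.2)) := by fun_prop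
  have hdens : Measurable (fun p : ℝ × ℝ => ENNReal.ofReal
      (gaussianPDFReal (a * p.1) v p.2 / gaussianPDFReal 0 v' p.2)) := by
    unfold gaussianPDFReal
    fun_prop
  ext s hs
  rw [Measure.map_apply hmeas hs, Measure.prod_apply (hmeas hs), withDensity_apply _ hs,
    ← lintegral_indicator hs, lintegral_prod _ (hdens.indicator hs).aemeasurable]
  refine lintegral_congr fun x => ?_
  have hsx : MeasurableSet (Prod.mk x ⁻¹' s) := measurable_prodMk_left hs
  calc gaussianReal 0 v (Prod.mk x ⁻¹' ((fun p : ℝ × ℝ => (p.1, a * p.1 + p.2)) ⁻¹' s))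
      = (gaussianReal 0 v).map (fun n => a * x + n) (Prod.mk x ⁻¹' s) :=
        (Measure.map_apply (by fun_prop) hsx).symm
    _ = gaussianReal (a * x) v (Prod.mk x ⁻¹' s) := by
        rw [gaussianReal_map_const_add, zero_add]
    _ = _ := by
        rw [← gaussianReal_withDensity_div (a * x) 0 hv hv', withDensity_apply _ hsx,
          ← lintegral_indicator hsx]
        rfl

/-- The second moment of a centered Gaussian. -/
lemma integral_sq_gaussianReal (v : NNReal) : ∫ x, x ^ 2 ∂gaussianReal 0 v = v := by
  rw [← variance_fun_id_gaussianReal (μ := 0) (v := v),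
    variance_of_integral_eq_zero (by fun_prop) integral_id_gaussianReal]

lemma integrable_sq_gaussianReal (m : ℝ) (v : NNReal) :
    Integrable (fun x => x ^ 2) (gaussianReal m v) :=
  (memLp_id_gaussianReal (μ := m) (v := v) 2).integrable_sq

/-- Mutual information of the forward-channel realization equals the
memoryless Gaussian rate-distortion function: with `α = √(1 − D/σ²)` and
`μ` the joint law of `(X, αX + N)` for `X ~ N(0,σ²)` independent of
`N ~ N(0,D)`, the second marginal of `μ` is `N(0,σ²)` and the KL divergence
of `μ` from `N(0,σ²) ⊗ N(0,σ²)` equals `(1/2) log(σ²/D)` nats. -/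
theorem forward_channel_mutual_information
    (σ2 D : NNReal) (hσ : 0 < σ2) (hDpos : 0 < D) (hDle : D ≤ σ2)
    (α : ℝ) (hα : α = Real.sqrt (1 - (D : ℝ) / (σ2 : ℝ)))
    (μ : Measure (ℝ × ℝ))
    (hμ : μ = Measure.map (fun p : ℝ × ℝ => (p.1, α * p.1 + p.2))
      ((gaussianReal 0 σ2).prod (gaussianReal 0 D))) :
    μ.map Prod.snd = gaussianReal 0 σ2 ∧
    klDiv μ ((gaussianReal 0 σ2).prod (gaussianReal 0 σ2))
      = (1/2) * Real.log ((σ2 : ℝ) / (D : ℝ)) := by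
  have hσ' : (0 : ℝ) < σ2 := hσ
  have hD' : (0 : ℝ) < D := hDpos
  have hα2 : α ^ 2 = 1 - (D : ℝ) / σ2 := by
    rw [hα, Real.sq_sqrt]
    rw [sub_nonneg, div_le_one hσ']
    exact_mod_cast hDle
  have hmeas : Measurable (fun p : ℝ × ℝ => (p.1, α * p.1 + p.2)) := by fun_prop
  have hsnd : μ.map Prod.snd = gaussianReal 0 σ2 := by
    have hfst : ((gaussianReal 0 σ2).prod (gaussianReal 0 D)).map (fun p => α * p.1) =
        gaussianReal (α * 0) (.mk (α ^ 2) (sq_nonneg _) * σ2) := by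
      rw [← gaussianReal_map_const_mul, ← Function.comp_def (fun x : ℝ => α * x) Prod.fst,
        ← Measure.map_map (by fun_prop) measurable_fst, Measure.map_fst_prod, measure_univ,
        one_smul]
    have hsum := gaussianReal_add_gaussianReal_of_indepFun
      (indepFun_prod (μ := gaussianReal 0 σ2) (ν := gaussianReal 0 D)
        (X := fun x => α * x) (Y := fun n => n) (by fun_prop) measurable_id) hfst
      (show _ = gaussianReal 0 D from measurePreserving_snd.map_eq)
    have hvar : .mk (α ^ 2) (sq_nonneg _) * σ2 + D = σ2 := by
      ext
      rw [NNReal.coe_add, NNReal.coe_mul, NNReal.coe_mk, hα2]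
      field_simp
      ring
    rw [hμ, Measure.map_map measurable_snd hmeas]
    rw [hvar, mul_zero, add_zero] at hsum
    exact hsum
  refine ⟨hsnd, ?_⟩
  have hdens := map_prod_gaussianReal_eq_withDensity α (gaussianReal 0 σ2) hDpos.ne' hσ.ne'
  rw [← hμ] at hdens
  have hac : μ ≪ (gaussianReal 0 σ2).prod (gaussianReal 0 σ2) :=
    hdens ▸ withDensity_absolutelyContinuous _ _
  have hrn : μ.rnDeriv ((gaussianReal 0 σ2).prod (gaussianReal 0 σ2)) =ᵐ[μ]
      fun p => ENNReal.ofReal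
        (gaussianPDFReal (α * p.1) D p.2 / gaussianPDFReal 0 σ2 p.2) := by
    refine hac.ae_le ?_
    rw [hdens]
    refine Measure.rnDeriv_withDensity _ ?_
    unfold gaussianPDFReal
    fun_prop
  have hint_noise : Integrable (fun p : ℝ × ℝ => (p.2 - α * p.1) ^ 2) μ := by
    rw [hμ, integrable_map_measure (by fun_prop) hmeas.aemeasurable]
    simpa [Function.comp_def] using (integrable_sq_gaussianReal 0 D).comp_snd (gaussianReal 0 σ2)
  have hnoise : ∫ p, (p.2 - α * p.1) ^ 2 ∂μ = D := by
    rw [hμ, integral_map hmeas.aemeasurable (by fun_prop)]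
    simp only [add_sub_cancel_left]
    rw [integral_fun_snd (fun y : ℝ => y ^ 2), integral_sq_gaussianReal]
    simp
  have hint_out : Integrable (fun p : ℝ × ℝ => p.2 ^ 2) μ := by
    have h := integrable_sq_gaussianReal 0 σ2
    rw [← hsnd] at h
    exact h.comp_measurable measurable_snd
  have hout : ∫ p, p.2 ^ 2 ∂μ = σ2 := by
    rw [← integral_sq_gaussianReal σ2, ← hsnd,
      integral_map measurable_snd.aemeasurable (by fun_prop)]
  have : IsProbabilityMeasure μ := hμ ▸ Measure.isProbabilityMeasure_map hmeas.aemeasurable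
  calc klDiv μ ((gaussianReal 0 σ2).prod (gaussianReal 0 σ2))
      = ∫ p, ((1 / 2) * Real.log ((σ2 : ℝ) / D) - (p.2 - α * p.1) ^ 2 / (2 * D)
          + p.2 ^ 2 / (2 * σ2)) ∂μ := by
        refine integral_congr_ae ?_
        filter_upwards [hrn] with p hp
        rw [hp, ENNReal.toReal_ofReal
          (div_nonneg (gaussianPDFReal_nonneg _ _ _) (gaussianPDFReal_nonneg _ _ _)),
          log_gaussianPDFReal_div _ _ hDpos hσ, sub_zero]
    _ = (1 / 2) * Real.log ((σ2 : ℝ) / D) - D / (2 * D) + σ2 / (2 * σ2) := by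
        rw [integral_add (by exact (integrable_const _).sub (hint_noise.div_const _))
          (hint_out.div_const _), integral_sub (integrable_const _) (hint_noise.div_const _),
          integral_div, integral_div, hnoise, hout]
        simp
    _ = (1 / 2) * Real.log ((σ2 : ℝ) / D) := by
        field_simp
        ring
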